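/- Let (q_n)_{n≥1} be a sequence of reals with 0 < q_n < 1. Assume that for every y ∈ (0,1) the series Σ_{n=3}^∞ sup_{0≤x≤1} D_n^{q_n}((t−x)²)(x) · yⁿ converges, where D_n^{q_n}((t−x)²)(x) denotes the operator D_n^{q_n} applied at the point x to the function t ↦ (t−x)², and define φ(y) = ((1−y) · sup_{0≤x≤1} Σ_{n=3}^∞ D_n^{q_n}((t−x)²)(x) yⁿ)^{1/2}. Then for every f ∈ C[0,1] and every y ∈ (0,1) with φ(y) > 0, (1−y) · sup_{0≤x≤1} |Σ_{n=3}^∞ (D_n^{q_n}(f)(x) − f(x)) yⁿ| ≤ 2 ω(f, φ(y)). -/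

import Mathlib

open Filter Topology

/-- The `q`-integer `[n]_q = 1 + q + ⋯ + q^{n-1}`. -/
noncomputable def qInt (q : ℝ) (n : ℕ) : ℝ := ∑ k ∈ Finset.range n, q ^ k

/-- The `q`-factorial `[n]_q!`. -/
noncomputable def qFact (q : ℝ) (n : ℕ) : ℝ := ∏ k ∈ Finset.range n, qInt q (k + 1)

/-- The `q`-binomial coefficient `[m choose r]_q`. -/
noncomputable def qBinom (q : ℝ) (m r : ℕ) : ℝ := qFact q m / (qFact q r * qFact q (m - r))

/-- The Jackson `q`-integral of `g` over `[0,1]`. -/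
noncomputable def qIntegral (q : ℝ) (g : ℝ → ℝ) : ℝ := (1 - q) * ∑' m : ℕ, q ^ m * g (q ^ m)

/-- The `q`-shifted factorial `(t;q)_n`. -/
noncomputable def qShift (q t : ℝ) (n : ℕ) : ℝ := ∏ j ∈ Finset.range n, (1 - t * q ^ j)

/-- The `q`-beta function `B_q(m,n)`. -/
noncomputable def qBeta (q : ℝ) (m n : ℕ) : ℝ :=
  qIntegral q (fun t => t ^ (m - 1) * qShift q (q * t) (n - 1))

/-- The weight `m_{n,k,q}(x) = (x;q)_{n+1} [n+k choose k]_q x^k`. -/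
noncomputable def mWeight (q : ℝ) (n k : ℕ) (x : ℝ) : ℝ :=
  qShift q x (n + 1) * qBinom q (n + k) k * x ^ k

/-- The `q`-MKZ–Durrmeyer operator. -/
noncomputable def Durr (q : ℝ) (n : ℕ) (f : ℝ → ℝ) (x : ℝ) : ℝ :=
  if x = 1 then f 1
  else mWeight q n 0 x * f 0 +
    ∑' k : ℕ, mWeight q n (k + 1) x * (1 / qBeta q n (k + 1)) *
      qIntegral q (fun t => t ^ k * qShift q (q * t) (n - 1) * f t)

/-- The modulus of continuity of `f` on `[0,1]`. -/
noncomputable def modulus (f : ℝ → ℝ) (δ : ℝ) : ℝ :=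
  sSup {z : ℝ | ∃ x y : ℝ, x ∈ Set.Icc (0 : ℝ) 1 ∧ y ∈ Set.Icc (0 : ℝ) 1 ∧
    |x - y| ≤ δ ∧ z = |f x - f y|}

/-- `φ(y) = ((1-y) · sup_x Σ_{n≥3} D_n^{q_n}((t-x)²)(x) yⁿ)^{1/2}`. -/
noncomputable def phiD (q : ℕ → ℝ) (y : ℝ) : ℝ :=
  Real.sqrt ((1 - y) * ⨆ x : Set.Icc (0 : ℝ) 1,
    ∑' n : ℕ, Durr (q (n + 3)) (n + 3) (fun t => (t - (x : ℝ)) ^ 2) x * y ^ (n + 3))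

section qCalculus

variable {q : ℝ}

theorem qInt_add (q : ℝ) (m n : ℕ) : qInt q (m + n) = qInt q m + q ^ m * qInt q n := by
  simp only [qInt, Finset.sum_range_add, Finset.mul_sum, pow_add]

theorem one_sub_mul_qInt (q : ℝ) (n : ℕ) : (1 - q) * qInt q n = 1 - q ^ n :=
  mul_neg_geom_sum q n

theorem one_le_qInt_succ (hq : 0 < q) (n : ℕ) : 1 ≤ qInt q (n + 1) := by
  rw [qInt, Finset.sum_range_succ', pow_zero]
  have : 0 ≤ ∑ k ∈ Finset.range n, q ^ (k + 1) := Finset.sum_nonneg fun k _ => by positivity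
  linarith

theorem qInt_succ_pos (hq : 0 < q) (n : ℕ) : 0 < qInt q (n + 1) :=
  one_pos.trans_le (one_le_qInt_succ hq n)

theorem qInt_le (hq : 0 < q) (hq1 : q < 1) (n : ℕ) : qInt q n ≤ (1 - q)⁻¹ := by
  rw [← one_div, le_div_iff₀ (by linarith), mul_comm, one_sub_mul_qInt]
  have : 0 < q ^ n := by positivity
  linarith

theorem qFact_succ (q : ℝ) (n : ℕ) : qFact q (n + 1) = qFact q n * qInt q (n + 1) :=
  Finset.prod_range_succ _ _

theorem qFact_zero (q : ℝ) : qFact q 0 = 1 := Finset.prod_range_zero _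

theorem qFact_pos (hq : 0 < q) (n : ℕ) : 0 < qFact q n :=
  Finset.prod_pos fun k _ => qInt_succ_pos hq k

theorem qShift_succ (q t : ℝ) (n : ℕ) : qShift q t (n + 1) = qShift q t n * (1 - t * q ^ n) :=
  Finset.prod_range_succ _ _

theorem one_sub_mul_pow_pos (hq : 0 < q) (hq1 : q < 1) {t : ℝ} (ht0 : 0 ≤ t) (ht : t < 1) (n : ℕ) :
    0 < 1 - t * q ^ n := by
  have : t * q ^ n ≤ t * 1 := mul_le_mul_of_nonneg_left (pow_le_one₀ hq.le hq1.le) ht0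
  linarith

theorem qShift_pos (hq : 0 < q) (hq1 : q < 1) {t : ℝ} (ht0 : 0 ≤ t) (ht : t < 1) (n : ℕ) :
    0 < qShift q t n :=
  Finset.prod_pos fun k _ => one_sub_mul_pow_pos hq hq1 ht0 ht k

theorem qBinom_add (q : ℝ) (n k : ℕ) :
    qBinom q (n + k) k = qFact q (n + k) / (qFact q k * qFact q n) := by
  rw [qBinom, Nat.add_sub_cancel]

theorem qBinom_add_pos (hq : 0 < q) (n k : ℕ) : 0 < qBinom q (n + k) k := by
  rw [qBinom_add]
  exact div_pos (qFact_pos hq _) (mul_pos (qFact_pos hq _) (qFact_pos hq _))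

theorem qBinom_pascal (hq : 0 < q) (n k : ℕ) :
    qBinom q (n + 1 + (k + 1)) (k + 1) =
      qBinom q (n + (k + 1)) (k + 1) + q ^ (n + 1) * qBinom q (n + 1 + k) k := by
  simp only [qBinom_add]
  rw [show n + 1 + (k + 1) = n + 1 + k + 1 by ring, show n + (k + 1) = n + 1 + k by ring,
    qFact_succ q (n + 1 + k), qFact_succ q k, qFact_succ q n,
    show n + 1 + k + 1 = n + 1 + (k + 1) by ring, qInt_add]
  have h1 := (qFact_pos hq k).ne'
  have h2 := (qFact_pos hq n).ne'
  have h3 := (qInt_succ_pos hq k).ne'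
  have h4 := (qInt_succ_pos hq n).ne'
  field_simp

theorem qBinom_add_le (hq : 0 < q) (hq1 : q < 1) (n k : ℕ) :
    qBinom q (n + k) k ≤ (1 - q)⁻¹ ^ n := by
  induction n with
  | zero =>
    rw [qBinom_add, zero_add, qFact_zero, mul_one, div_self (qFact_pos hq k).ne', pow_zero]
  | succ n ih =>
    have hstep : qBinom q (n + 1 + k) k =
        qBinom q (n + k) k * (qInt q (n + k + 1) / qInt q (n + 1)) := by
      rw [qBinom_add, qBinom_add, show n + 1 + k = n + k + 1 by ring, qFact_succ, qFact_succ,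
        div_mul_div_comm, mul_assoc]
    have hle : qInt q (n + k + 1) / qInt q (n + 1) ≤ (1 - q)⁻¹ :=
      (div_le_self (qInt_succ_pos hq _).le (one_le_qInt_succ hq n)).trans (qInt_le hq hq1 _)
    rw [hstep, pow_succ]
    exact mul_le_mul ih hle (div_pos (qInt_succ_pos hq _) (qInt_succ_pos hq _)).le
      (pow_nonneg (inv_nonneg.2 (by linarith)) n)

theorem summable_qBinom_mul_pow (hq : 0 < q) (hq1 : q < 1) {x : ℝ} (hx0 : 0 ≤ x) (hx : x < 1)
    (n : ℕ) : Summable fun k => qBinom q (n + k) k * x ^ k :=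
  Summable.of_nonneg_of_le (fun k => mul_nonneg (qBinom_add_pos hq n k).le (pow_nonneg hx0 k))
    (fun k => mul_le_mul_of_nonneg_right (qBinom_add_le hq hq1 n k) (pow_nonneg hx0 k))
    ((summable_geometric_of_lt_one hx0 hx).mul_left _)

/-- The `q`-binomial theorem in the form `(x;q)_{n+1} Σ_k [n+k choose k]_q x^k = 1`. -/
theorem qShift_mul_tsum_qBinom (hq : 0 < q) (hq1 : q < 1) {x : ℝ} (hx0 : 0 ≤ x) (hx : x < 1)
    (n : ℕ) : qShift q x (n + 1) * ∑' k, qBinom q (n + k) k * x ^ k = 1 := by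
  induction n with
  | zero =>
    have h1 (k : ℕ) : qBinom q (0 + k) k = 1 := by
      rw [qBinom_add, zero_add, qFact_zero, mul_one, div_self (qFact_pos hq k).ne']
    simp only [h1, one_mul, tsum_geometric_of_lt_one hx0 hx]
    simp only [qShift, zero_add, Finset.prod_range_one, pow_zero, mul_one]
    exact mul_inv_cancel₀ (by linarith)
  | succ n ih =>
    have hs := summable_qBinom_mul_pow hq hq1 hx0 hx n
    have hs' := summable_qBinom_mul_pow hq hq1 hx0 hx (n + 1)
    have hrec : ∑' k, qBinom q (n + 1 + k) k * x ^ k =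
        ∑' k, qBinom q (n + k) k * x ^ k +
          x * q ^ (n + 1) * ∑' k, qBinom q (n + 1 + k) k * x ^ k := by
      conv_lhs => rw [hs'.tsum_eq_zero_add]
      have hadd := ((summable_nat_add_iff 1).2 hs).tsum_add (hs'.mul_left (x * q ^ (n + 1)))
      rw [hs.tsum_eq_zero_add, ← tsum_mul_left, add_assoc (qBinom q (n + 0) 0 * x ^ 0)]
      refine Eq.trans ?_ (congrArg _ hadd)
      congr 1
      · rw [qBinom_add, qBinom_add]
        simp only [add_zero, qFact_zero, one_mul, div_self (qFact_pos hq _).ne']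
      · refine tsum_congr fun k => ?_
        rw [qBinom_pascal hq]
        ring
    rw [qShift_succ, mul_assoc, sub_mul, one_mul, sub_eq_of_eq_add hrec, ih]

theorem hasSum_mWeight (hq : 0 < q) (hq1 : q < 1) {x : ℝ} (hx0 : 0 ≤ x) (hx : x < 1) (n : ℕ) :
    HasSum (fun k => mWeight q n k x) 1 := by
  have h := (summable_qBinom_mul_pow hq hq1 hx0 hx n).hasSum.mul_left (qShift q x (n + 1))
  rw [qShift_mul_tsum_qBinom hq hq1 hx0 hx] at h
  simpa only [mWeight, mul_assoc] using h

theorem mWeight_nonneg (hq : 0 < q) (hq1 : q < 1) {x : ℝ} (hx0 : 0 ≤ x) (hx : x < 1) (n k : ℕ) :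
    0 ≤ mWeight q n k x :=
  mul_nonneg (mul_nonneg (qShift_pos hq hq1 hx0 hx _).le (qBinom_add_pos hq n k).le)
    (pow_nonneg hx0 k)

/-- Evaluation of the `q`-beta integral `∫_0^1 t^a (qt;q)_b d_q t`. -/
theorem hasSum_qBeta (hq : 0 < q) (hq1 : q < 1) (a b : ℕ) :
    HasSum (fun m : ℕ => (1 - q) * (q ^ m * ((q ^ m) ^ a * qShift q (q * q ^ m) b)))
      (qFact q a * qFact q b / qFact q (a + b + 1)) := by
  induction b generalizing a with
  | zero =>
    have hlt : q ^ (a + 1) < 1 := pow_lt_one₀ hq.le hq1 (Nat.succ_ne_zero a)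
    have h := (hasSum_geometric_of_lt_one (pow_nonneg hq.le (a + 1)) hlt).mul_left (1 - q)
    have hval : qFact q a * qFact q 0 / qFact q (a + 0 + 1) =
        (1 - q) * (1 - q ^ (a + 1))⁻¹ := by
      have h1 := (qFact_pos hq a).ne'
      have h2 := (qInt_succ_pos hq a).ne'
      have h3 : 1 - q ≠ 0 := by linarith
      rw [← one_sub_mul_qInt, add_zero, qFact_succ, qFact_zero]
      field_simp
    rw [hval]
    refine h.congr_fun fun m => ?_
    simp only [qShift, Finset.prod_range_zero]
    ring
  | succ b ih =>
    have hval : qFact q a * qFact q (b + 1) / qFact q (a + (b + 1) + 1) =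
        qFact q a * qFact q b / qFact q (a + b + 1) -
          q ^ (b + 1) * (qFact q (a + 1) * qFact q b / qFact q (a + 1 + b + 1)) := by
      have h1 := (qFact_pos hq (a + b + 1)).ne'
      have h2 := (qInt_succ_pos hq (a + b + 1)).ne'
      rw [show a + (b + 1) + 1 = a + b + 1 + 1 by ring, show a + 1 + b + 1 = a + b + 1 + 1 by ring,
        qFact_succ q (a + b + 1), qFact_succ q a, qFact_succ q b]
      have h3 : qInt q (a + b + 1 + 1) = qInt q (b + 1) + q ^ (b + 1) * qInt q (a + 1) := by
        rw [← qInt_add]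
        congr 1
        ring
      field_simp
      rw [h3]
      ring
    rw [hval]
    refine ((ih a).sub ((ih (a + 1)).mul_left (q ^ (b + 1)))).congr_fun fun m => ?_
    rw [qShift_succ]
    ring

theorem qBeta_succ (hq : 0 < q) (hq1 : q < 1) {n : ℕ} (k : ℕ) :
    qBeta q n (k + 1) = qFact q (n - 1) * qFact q k / qFact q (n - 1 + k + 1) := by
  rw [qBeta, qIntegral, ← tsum_mul_left]
  exact (hasSum_qBeta hq hq1 (n - 1) k).tsum_eq

end qCalculus

/-- A normalized positive functional on bounded functions on `[0,1]`, described by the inequality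
`|L f - c| ≤ A + B * L g` it inherits from the pointwise one. -/
def IsMean (L : (ℝ → ℝ) → ℝ) : Prop :=
  ∀ (f g : ℝ → ℝ) (c A B : ℝ), 0 ≤ B → (∀ t ∈ Set.Icc (0 : ℝ) 1, 0 ≤ g t ∧ g t ≤ 1) →
    (∀ t ∈ Set.Icc (0 : ℝ) 1, |f t - c| ≤ A + B * g t) → |L f - c| ≤ A + B * L g

namespace IsMean

theorem abs_sub_le {L : (ℝ → ℝ) → ℝ} (hL : IsMean L) {f : ℝ → ℝ} {c A : ℝ}
    (hf : ∀ t ∈ Set.Icc (0 : ℝ) 1, |f t - c| ≤ A) : |L f - c| ≤ A := by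
  simpa using hL f (fun _ => 0) c A 0 le_rfl (fun _ _ => by simp) (by simpa using hf)

theorem mem_Icc {L : (ℝ → ℝ) → ℝ} (hL : IsMean L) {g : ℝ → ℝ}
    (hg : ∀ t ∈ Set.Icc (0 : ℝ) 1, 0 ≤ g t ∧ g t ≤ 1) : 0 ≤ L g ∧ L g ≤ 1 := by
  have h : |L g - 1 / 2| ≤ 1 / 2 := hL.abs_sub_le fun t ht => by
    rw [abs_le]
    constructor <;> linarith [(hg t ht).1, (hg t ht).2]
  rw [abs_le] at h
  constructor <;> linarith [h.1, h.2]

theorem pointEvaluation {t : ℝ} (ht : t ∈ Set.Icc (0 : ℝ) 1) : IsMean fun f => f t :=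
  fun _ _ _ _ _ _ _ hf => hf t ht

theorem summable_mul {w : ℕ → ℝ} {Λ : ℕ → (ℝ → ℝ) → ℝ} (hw0 : ∀ k, 0 ≤ w k) (hw : Summable w)
    (hΛ : ∀ k, IsMean (Λ k)) {f : ℝ → ℝ} {c A : ℝ}
    (hf : ∀ t ∈ Set.Icc (0 : ℝ) 1, |f t - c| ≤ A) : Summable fun k => w k * Λ k f := by
  have h : Summable fun k => w k * (Λ k f - c) := by
    refine Summable.of_norm_bounded (hw.mul_right A) fun k => ?_
    rw [Real.norm_eq_abs, abs_mul, abs_of_nonneg (hw0 k)]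
    exact mul_le_mul_of_nonneg_left ((hΛ k).abs_sub_le hf) (hw0 k)
  simpa [mul_sub] using h.add (hw.mul_right c)

theorem of_hasSum {w : ℕ → ℝ} {Λ : ℕ → (ℝ → ℝ) → ℝ} {L : (ℝ → ℝ) → ℝ} (hw0 : ∀ k, 0 ≤ w k)
    (hw : HasSum w 1) (hΛ : ∀ k, IsMean (Λ k))
    (hL : ∀ f : ℝ → ℝ, (Summable fun k => w k * Λ k f) → L f = ∑' k, w k * Λ k f) :
    IsMean L := by
  intro f g c A B hB hg hf
  have hfs : Summable fun k => w k * Λ k f :=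
    summable_mul hw0 hw.summable hΛ (A := A + B) fun t ht => (hf t ht).trans (by
      have := mul_le_mul_of_nonneg_left (hg t ht).2 hB
      linarith)
  have hgs : Summable fun k => w k * Λ k g :=
    summable_mul hw0 hw.summable hΛ (c := 0) (A := 1) fun t ht => by
      rw [sub_zero, abs_of_nonneg (hg t ht).1]
      exact (hg t ht).2
  have hF : HasSum (fun k => w k * (Λ k f - c)) (L f - c) := by
    rw [hL f hfs]
    simpa [mul_sub] using hfs.hasSum.sub (hw.mul_right c)
  have hG : HasSum (fun k => w k * (A + B * Λ k g)) (A + B * L g) := by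
    rw [hL g hgs]
    have h := (hw.mul_left A).add (hgs.hasSum.mul_left B)
    rw [mul_one] at h
    exact h.congr_fun fun k => by ring
  rw [← hF.tsum_eq, ← hG.tsum_eq, ← Real.norm_eq_abs]
  refine tsum_of_norm_bounded hG.summable.hasSum fun k => ?_
  rw [Real.norm_eq_abs, abs_mul, abs_of_nonneg (hw0 k)]
  exact mul_le_mul_of_nonneg_left (hΛ k f g c A B hB hg hf) (hw0 k)

end IsMean

theorem isMean_qBeta {q : ℝ} (hq : 0 < q) (hq1 : q < 1) (n k : ℕ) :
    IsMean fun f => 1 / qBeta q n (k + 1) *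
      qIntegral q (fun t => t ^ k * qShift q (q * t) (n - 1) * f t) := by
  have hβ : 0 < qBeta q n (k + 1) := by
    rw [qBeta_succ hq hq1]
    exact div_pos (mul_pos (qFact_pos hq _) (qFact_pos hq _)) (qFact_pos hq _)
  refine IsMean.of_hasSum (w := fun m => 1 / qBeta q n (k + 1) *
    ((1 - q) * (q ^ m * ((q ^ m) ^ k * qShift q (q * q ^ m) (n - 1)))))
    (Λ := fun m f => f (q ^ m)) (fun m => ?_) ?_
    (fun m => IsMean.pointEvaluation ⟨by positivity, pow_le_one₀ hq.le hq1.le⟩) fun f _ => ?_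
  · have h1 : 0 < qShift q (q * q ^ m) (n - 1) := by
      rw [← pow_succ']
      exact qShift_pos hq hq1 (by positivity) (pow_lt_one₀ hq.le hq1 (Nat.succ_ne_zero m)) _
    have h2 : 0 < 1 - q := by linarith
    positivity
  · have h := (hasSum_qBeta hq hq1 k (n - 1)).mul_left (1 / qBeta q n (k + 1))
    have hval : qFact q k * qFact q (n - 1) / qFact q (k + (n - 1) + 1) = qBeta q n (k + 1) := by
      rw [qBeta_succ hq hq1, mul_comm (qFact q k), add_comm k]
    rwa [hval, one_div_mul_cancel hβ.ne'] at h
  · simp only [qIntegral, ← tsum_mul_left]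
    exact tsum_congr fun m => by ring

theorem isMean_Durr {q : ℝ} (hq : 0 < q) (hq1 : q < 1) (n : ℕ) {x : ℝ}
    (hx : x ∈ Set.Icc (0 : ℝ) 1) : IsMean fun f => Durr q n f x := by
  rcases eq_or_ne x 1 with rfl | hx1
  · simpa [Durr] using IsMean.pointEvaluation (Set.right_mem_Icc.2 zero_le_one)
  have hlt : x < 1 := lt_of_le_of_ne hx.2 hx1
  refine IsMean.of_hasSum (w := fun k => mWeight q n k x)
    (Λ := fun k f => Nat.casesOn k (f 0) fun j => 1 / qBeta q n (j + 1) *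
      qIntegral q (fun t => t ^ j * qShift q (q * t) (n - 1) * f t))
    (mWeight_nonneg hq hq1 hx.1 hlt n) (hasSum_mWeight hq hq1 hx.1 hlt n) ?_ fun f hf => ?_
  · rintro (_ | j)
    · exact IsMean.pointEvaluation (Set.left_mem_Icc.2 zero_le_one)
    · exact isMean_qBeta hq hq1 n j
  · rw [hf.tsum_eq_zero_add]
    simp only [Durr, if_neg hx1, mul_assoc (mWeight _ _ _ _)]
    rfl

theorem abs_sub_le_modulus {f : ℝ → ℝ} (hf : ContinuousOn f (Set.Icc 0 1)) {δ s t : ℝ}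
    (hs : s ∈ Set.Icc (0 : ℝ) 1) (ht : t ∈ Set.Icc (0 : ℝ) 1) (hst : |s - t| ≤ δ) :
    |f s - f t| ≤ modulus f δ := by
  obtain ⟨M, hM⟩ := isCompact_Icc.exists_bound_of_continuousOn hf
  refine le_csSup ⟨M + M, ?_⟩ ⟨s, t, hs, ht, hst, rfl⟩
  rintro _ ⟨a, b, ha, hb, -, rfl⟩
  exact (abs_sub _ _).trans (add_le_add (hM a ha) (hM b hb))

theorem modulus_nonneg (f : ℝ → ℝ) (δ : ℝ) : 0 ≤ modulus f δ :=
  Real.sSup_nonneg (by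
    rintro _ ⟨a, b, -, -, -, rfl⟩
    exact abs_nonneg _)

theorem abs_sub_le_nat_mul_modulus {f : ℝ → ℝ} (hf : ContinuousOn f (Set.Icc 0 1)) {δ : ℝ}
    (N : ℕ) {s t : ℝ} (hs : s ∈ Set.Icc (0 : ℝ) 1) (ht : t ∈ Set.Icc (0 : ℝ) 1)
    (hst : |s - t| ≤ (N + 1) * δ) : |f s - f t| ≤ (N + 1) * modulus f δ := by
  induction N generalizing s with
  | zero => simpa using abs_sub_le_modulus hf hs ht (by simpa using hst)
  | succ N ih =>
    -- the point dividing `[s, t]` in the ratio `1 : N + 1`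
    have hN : (0 : ℝ) < N + 2 := by positivity
    set u : ℝ := s + (t - s) / (N + 2) with hu
    have hu' : u = (1 - 1 / (N + 2)) * s + 1 / (N + 2) * t := by rw [hu]; ring
    have h1 : 1 / ((N : ℝ) + 2) ≤ 1 := by rw [div_le_one hN]; linarith [N.cast_nonneg (α := ℝ)]
    have humem : u ∈ Set.Icc (0 : ℝ) 1 := by
      rw [hu']
      have h2 : 0 ≤ 1 - 1 / ((N : ℝ) + 2) := by linarith
      exact convex_Icc (0 : ℝ) 1 hs ht h2 (by positivity : 0 ≤ 1 / ((N : ℝ) + 2)) (by ring)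
    push_cast at hst ⊢
    have hst' : |s - t| / (N + 2) ≤ δ := by
      rw [div_le_iff₀ hN]
      linarith
    have hsu : |s - u| ≤ δ := by
      rw [show s - u = (s - t) / (N + 2) by rw [hu]; ring, abs_div, abs_of_pos hN]
      exact hst'
    have hut : |u - t| ≤ (N + 1) * δ := by
      rw [show u - t = (N + 1) * ((s - t) / (N + 2)) by rw [hu]; field_simp; ring, abs_mul, abs_div,
        abs_of_pos hN, abs_of_nonneg (by positivity : (0 : ℝ) ≤ N + 1)]
      exact mul_le_mul_of_nonneg_left hst' (by positivity)
    have h2 := abs_sub_le (f s) (f u) (f t)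
    have h3 := abs_sub_le_modulus hf hs humem hsu
    have h4 := ih humem hut
    linarith

theorem abs_sub_le_modulus_add {f : ℝ → ℝ} (hf : ContinuousOn f (Set.Icc 0 1)) {δ : ℝ}
    (hδ : 0 < δ) {s t : ℝ} (hs : s ∈ Set.Icc (0 : ℝ) 1) (ht : t ∈ Set.Icc (0 : ℝ) 1) :
    |f s - f t| ≤ modulus f δ + modulus f δ / δ ^ 2 * (s - t) ^ 2 := by
  have hω := modulus_nonneg f δ
  rcases le_or_gt |s - t| δ with h | h
  · have h1 := abs_sub_le_modulus hf hs ht h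
    have : 0 ≤ modulus f δ / δ ^ 2 * (s - t) ^ 2 := by positivity
    linarith
  · set r := |s - t| / δ with hr
    have hr1 : 1 ≤ r := by rw [hr, one_le_div hδ]; exact h.le
    have h1 : |s - t| = r * δ := by rw [hr]; field_simp
    have h2 := abs_sub_le_nat_mul_modulus hf (δ := δ) ⌊r⌋₊ hs ht
      (h1.le.trans (mul_le_mul_of_nonneg_right (Nat.lt_floor_add_one r).le hδ.le))
    have h3 : (⌊r⌋₊ : ℝ) ≤ r := Nat.floor_le (by linarith)
    have h4 : modulus f δ / δ ^ 2 * (s - t) ^ 2 = r ^ 2 * modulus f δ := by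
      rw [← sq_abs (s - t), h1]
      field_simp
    rw [h4]
    calc |f s - f t| ≤ (⌊r⌋₊ + 1) * modulus f δ := h2
      _ ≤ (1 + r ^ 2) * modulus f δ := mul_le_mul_of_nonneg_right (by nlinarith) hω
      _ = modulus f δ + r ^ 2 * modulus f δ := by ring

theorem sq_sub_mem_Icc {s t : ℝ} (hs : s ∈ Set.Icc (0 : ℝ) 1) (ht : t ∈ Set.Icc (0 : ℝ) 1) :
    0 ≤ (s - t) ^ 2 ∧ (s - t) ^ 2 ≤ 1 := by
  refine ⟨sq_nonneg _, ?_⟩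
  rw [sq_le_one_iff_abs_le_one, abs_le]
  constructor <;> linarith [hs.1, hs.2, ht.1, ht.2]

theorem stmt13 (q : ℕ → ℝ) (hq : ∀ n : ℕ, 1 ≤ n → 0 < q n ∧ q n < 1)
    (hsum : ∀ y ∈ Set.Ioo (0 : ℝ) 1,
      Summable (fun n : ℕ =>
        (⨆ x : Set.Icc (0 : ℝ) 1, Durr (q (n + 3)) (n + 3) (fun t => (t - (x : ℝ)) ^ 2) x) *
          y ^ (n + 3)))
    (f : ℝ → ℝ) (hf : ContinuousOn f (Set.Icc 0 1))
    (y : ℝ) (hy : y ∈ Set.Ioo (0 : ℝ) 1) (hφ : 0 < phiD q y) :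
    (1 - y) * ⨆ x : Set.Icc (0 : ℝ) 1,
        |∑' n : ℕ, (Durr (q (n + 3)) (n + 3) f x - f x) * y ^ (n + 3)| ≤
      2 * modulus f (phiD q y) := by
  obtain ⟨hy0, hy1⟩ := hy
  have hgeo : HasSum (fun n : ℕ => y ^ (n + 3)) (y ^ 3 * (1 - y)⁻¹) := by
    simpa only [pow_add, mul_comm] using
      (hasSum_geometric_of_lt_one hy0.le hy1).mul_left (y ^ 3)
  have hmean (x : Set.Icc (0 : ℝ) 1) (n : ℕ) :
      IsMean fun f => Durr (q (n + 3)) (n + 3) f x :=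
    isMean_Durr (hq (n + 3) (by omega)).1 (hq (n + 3) (by omega)).2 (n + 3) x.2
  have hsq (x : Set.Icc (0 : ℝ) 1) (n : ℕ) :=
    (hmean x n).mem_Icc (g := fun t => (t - (x : ℝ)) ^ 2) fun t ht => sq_sub_mem_Icc ht x.2
  have hle (x : Set.Icc (0 : ℝ) 1) (n : ℕ) :
      Durr (q (n + 3)) (n + 3) (fun t => (t - (x : ℝ)) ^ 2) x * y ^ (n + 3) ≤ y ^ (n + 3) :=
    mul_le_of_le_one_left (by positivity) (hsq x n).2
  have hS (x : Set.Icc (0 : ℝ) 1) : Summable fun n : ℕ =>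
      Durr (q (n + 3)) (n + 3) (fun t => (t - (x : ℝ)) ^ 2) x * y ^ (n + 3) :=
    Summable.of_nonneg_of_le (fun n => mul_nonneg (hsq x n).1 (by positivity)) (hle x)
      hgeo.summable
  have hbdd : BddAbove (Set.range fun x : Set.Icc (0 : ℝ) 1 => ∑' n : ℕ,
      Durr (q (n + 3)) (n + 3) (fun t => (t - (x : ℝ)) ^ 2) x * y ^ (n + 3)) := by
    refine ⟨∑' n : ℕ, y ^ (n + 3), ?_⟩
    rintro _ ⟨x, rfl⟩
    exact (hS x).tsum_le_tsum (hle x) hgeo.summable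
  have hφsq := Real.sq_sqrt (Real.sqrt_pos.1 hφ).le
  rw [← phiD] at hφsq
  set δ := phiD q y
  have hω := modulus_nonneg f δ
  have h1y : 0 < 1 - y := by linarith
  rw [mul_comm, ← le_div_iff₀ h1y]
  refine ciSup_le fun x => ?_
  have hmajor := (hgeo.mul_left (modulus f δ)).add ((hS x).hasSum.mul_left (modulus f δ / δ ^ 2))
  have hbound := tsum_of_norm_bounded (f := fun n : ℕ =>
    (Durr (q (n + 3)) (n + 3) f x - f x) * y ^ (n + 3)) hmajor fun n => by
      have h := hmean x n f (fun t => (t - (x : ℝ)) ^ 2) (f x) (modulus f δ)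
        (modulus f δ / δ ^ 2) (by positivity) (fun t ht => sq_sub_mem_Icc ht x.2)
        fun t ht => abs_sub_le_modulus_add hf hφ ht x.2
      rw [Real.norm_eq_abs, abs_mul, abs_of_pos (pow_pos hy0 (n + 3))]
      refine (mul_le_mul_of_nonneg_right h (pow_pos hy0 (n + 3)).le).trans_eq ?_
      ring
  rw [Real.norm_eq_abs] at hbound
  refine hbound.trans ?_
  rw [le_div_iff₀ h1y]
  have hsup := mul_le_mul_of_nonneg_left (le_ciSup hbdd x) h1y.le
  rw [← hφsq] at hsup
  have hy3 : y ^ 3 ≤ 1 := pow_le_one₀ hy0.le hy1.le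
  calc _ = modulus f δ * y ^ 3 + modulus f δ / δ ^ 2 * ((1 - y) * ∑' n : ℕ,
        Durr (q (n + 3)) (n + 3) (fun t => (t - (x : ℝ)) ^ 2) x * y ^ (n + 3)) := by
        field_simp
    _ ≤ modulus f δ * 1 + modulus f δ / δ ^ 2 * δ ^ 2 :=
        add_le_add (mul_le_mul_of_nonneg_left hy3 hω)
          (mul_le_mul_of_nonneg_left hsup (by positivity))
    _ = 2 * modulus f δ := by field_simp; ring
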